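/- The tilting graph of the category of finite-dimensional representations of the linear quiver A_r: 1 → 2 → ⋯ → r over a field k is connected. Equivalently, any two complete tilting modules over the path algebra kA_r (linearly oriented) are connected by a sequence of single-summand mutations. -/

import Mathlib

/-!
STATEMENT 18: The tilting graph of the category of finite-dimensional representations
of the linearly oriented quiver A_r : 1 → 2 → ⋯ → r over a field k is connected:
any two complete tilting modules over the path algebra kA_r are connected by a
sequence of single-summand mutations.

The path algebra of the linearly oriented A_r quiver is realized as the algebra of
upper triangular r × r matrices over k.  A (basic, complete) tilting module is a
family of r pairwise non-isomorphic finite indecomposable modules T = T₁ ⊕ ⋯ ⊕ T_r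
with Ext¹(T,T) = 0.  Two tilting modules are adjacent in the tilting graph iff they
differ in exactly one indecomposable summand (up to isomorphism and reindexing).
-/

open CategoryTheory

/-- The algebra of upper triangular `r × r` matrices over `k`,
isomorphic to the path algebra of the linearly oriented quiver `A_r`. -/
def UpperTriangular (k : Type) [Field k] (r : ℕ) :
    Subalgebra k (Matrix (Fin r) (Fin r) k) :=
  { carrier := {M | M.BlockTriangular (id : Fin r → Fin r)}
    mul_mem' := fun ha hb => Matrix.BlockTriangular.mul ha hb
    one_mem' := Matrix.blockTriangular_one
    add_mem' := fun ha hb => Matrix.BlockTriangular.add ha hb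
    zero_mem' := Matrix.blockTriangular_zero
    algebraMap_mem' := fun c => by
      rw [Matrix.algebraMap_eq_diagonal]
      exact Matrix.blockTriangular_diagonal _ }

variable (k : Type) [Field k] (r : ℕ)
  [HasExt.{0} (ModuleCat.{0} ↥(UpperTriangular k r))]

/-- A basic complete tilting module over `kA_r`: `r` pairwise non-isomorphic
finite indecomposable modules with no self-extensions. -/
structure TiltingFamily where
  M : Fin r → ModuleCat.{0} ↥(UpperTriangular k r)
  finite : ∀ i, Module.Finite ↥(UpperTriangular k r) (M i)
  nonzero : ∀ i, ¬ Limits.IsZero (M i)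
  indec : ∀ (i : Fin r) (Y Z : ModuleCat.{0} ↥(UpperTriangular k r)),
    (M i ≅ Y ⊞ Z) → Limits.IsZero Y ∨ Limits.IsZero Z
  rigid : ∀ i j, Subsingleton (Abelian.Ext (M i) (M j) 1)
  pairwise_noniso : ∀ i j, i ≠ j → ¬ Nonempty (M i ≅ M j)

/-- Two tilting families represent the same basic tilting module
(they agree up to isomorphism and reindexing). -/
def SameTilting (T T' : TiltingFamily k r) : Prop :=
  ∃ σ : Fin r ≃ Fin r, ∀ i, Nonempty (T.M i ≅ T'.M (σ i))

/-- Two tilting families differ in exactly one indecomposable summand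
(an edge of the tilting graph: a single mutation). -/
def MutationStep (T T' : TiltingFamily k r) : Prop :=
  ∃ (σ : Fin r ≃ Fin r) (i₀ : Fin r),
    (∀ i, i ≠ i₀ → Nonempty (T.M i ≅ T'.M (σ i))) ∧
    ¬ Nonempty (T.M i₀ ≅ T'.M (σ i₀))

namespace TiltA
def Cross (p q : ℕ × ℕ) : Prop := p.1 < q.1 ∧ q.1 ≤ p.2 ∧ p.2 < q.2

structure Good (r : ℕ) (T : Finset (ℕ × ℕ)) : Prop where
  lt : ∀ p ∈ T, p.1 < p.2
  le : ∀ p ∈ T, p.2 ≤ r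
  nc : ∀ p ∈ T, ∀ q ∈ T, ¬ Cross p q

/-- the largest element below `b` satisfying `P`, or a default -/
theorem exists_last (P : ℕ → Prop) (a b : ℕ) (hab : a < b) :
    ∃ z, a ≤ z ∧ z < b ∧ (z = a ∨ P z) ∧ ∀ w, z < w → w < b → ¬ P w := by
  induction b with
  | zero => omega
  | succ b ih =>
    by_cases hb : P b
    · exact ⟨b, by omega, by omega, Or.inr hb, fun w h1 h2 => by omega⟩
    · by_cases h : a < b
      · obtain ⟨z, h1, h2, h3, h4⟩ := ih h
        refine ⟨z, h1, by omega, h3, fun w hw hw' => ?_⟩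
        by_cases e : w = b
        · exact e ▸ hb
        · exact h4 w hw (by omega)
      · exact ⟨a, le_rfl, hab, Or.inl rfl, fun w h1 h2 => by omega⟩

theorem Good.card_le {r : ℕ} {T : Finset (ℕ × ℕ)} (h : Good r T) : T.card ≤ r := by
  classical
  have key : ∀ p : ℕ × ℕ, ∃ z, p ∈ T → (p.1 ≤ z ∧ z < p.2 ∧ (z = p.1 ∨ (p.1, z) ∈ T) ∧
      ∀ w, z < w → w < p.2 → (p.1, w) ∉ T) := by
    intro p
    by_cases hp : p ∈ T
    · obtain ⟨z, hz⟩ := exists_last (fun z => (p.1, z) ∈ T) p.1 p.2 (h.lt p hp)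
      exact ⟨z, fun _ => hz⟩
    · exact ⟨0, fun h => absurd h hp⟩
  choose e he using key
  have main : ∀ p ∈ T, ∀ q ∈ T, e p = e q → p.1 ≤ q.1 → q.2 ≤ p.2 → p = q := by
    rintro ⟨a, b⟩ hp ⟨c, d⟩ hq heq h1 h2
    obtain ⟨k1, k2, k3, k4⟩ := he _ hp
    obtain ⟨l1, l2, l3, l4⟩ := he _ hq
    rw [← heq] at l1 l2 l3 l4
    simp only at *
    generalize e (a, b) = z at *
    by_cases hac : a = c
    · subst hac
      by_cases hbd : d = b
      · rw [hbd]
      · exact absurd hq (k4 d (by omega) (by omega))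
    · rcases k3 with k3 | k3
      · omega
      · exact absurd ⟨by simp only; omega, by simp only; omega, by simp only; omega⟩ (h.nc _ k3 _ hq)
  have := Finset.card_le_card_of_injOn (s := T) (t := Finset.range r) e
    (by
      intro p hp
      have := he p hp
      have := h.le p hp
      simp; omega)
    (by
      intro p hp q hq heq
      have hp : p ∈ T := hp
      have hq : q ∈ T := hq
      obtain ⟨k1, k2, -, -⟩ := he _ hp
      obtain ⟨l1, l2, -, -⟩ := he _ hq
      have n1 := h.nc _ hp _ hq
      have n2 := h.nc _ hq _ hp
      unfold Cross at n1 n2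
      by_cases c : p.1 ≤ q.1 ∧ q.2 ≤ p.2
      · exact main p hp q hq heq c.1 c.2
      · exact (main q hq p hp heq.symm (by omega) (by omega)).symm)
  simpa using this

theorem Good.mem_of {r : ℕ} {T : Finset (ℕ × ℕ)} (h : Good r T) (hc : T.card = r) (x : ℕ × ℕ)
    (h1 : x.1 < x.2) (h2 : x.2 ≤ r) (h3 : ∀ p ∈ T, ¬ Cross p x ∧ ¬ Cross x p) : x ∈ T := by
  by_contra hx
  have : Good r (insert x T) := by
    refine ⟨?_, ?_, ?_⟩
    · simp only [Finset.mem_insert]; rintro p (rfl | hp); exacts [h1, h.lt p hp]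
    · simp only [Finset.mem_insert]; rintro p (rfl | hp); exacts [h2, h.le p hp]
    · simp only [Finset.mem_insert]
      rintro p (rfl | hp) q (rfl | hq)
      · unfold Cross; omega
      · exact (h3 q hq).2
      · exact (h3 p hp).1
      · exact h.nc p hp q hq
  have := this.card_le
  rw [Finset.card_insert_of_notMem hx] at this
  omega

theorem Good.flip {r : ℕ} {T : Finset (ℕ × ℕ)} (h : Good r T) (hc : T.card = r)
    (m : ℕ) (hm : 0 < m) (hmr : m ≤ r) (hmT : (0, m) ∉ T) :
    ∃ x ∈ T, ∃ z, x.1 ≠ 0 ∧ 0 < z ∧ z ≤ r ∧ (0, z) ∉ T ∧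
      ∀ p ∈ T, p ≠ x → ¬ Cross p (0, z) ∧ ¬ Cross (0, z) p := by
  classical
  have hr : (0, r) ∈ T := h.mem_of hc _ (by simp only; omega) le_rfl (by
    intro p hp
    have := h.le p hp
    unfold Cross; simp only; omega)
  obtain ⟨p, -, p2, p3, p4⟩ := exists_last (fun z => (0, z) ∈ T) 0 m hm
  have hq : ∃ q, m < q ∧ (0, q) ∈ T := ⟨r, by
    rcases hmr.lt_or_eq with h | h
    · exact h
    · exact absurd (h ▸ hr) hmT, hr⟩
  obtain ⟨q1, q2⟩ := Nat.find_spec hq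
  have q3 : ∀ w, w < Nat.find hq → m < w → (0, w) ∉ T := fun w hw hw' hh =>
    Nat.find_min hq hw ⟨hw', hh⟩
  generalize Nat.find hq = q at *
  obtain ⟨z, z1, z2, z3, z4⟩ := exists_last (fun z => (p + 1, z) ∈ T) (p+1) q (by omega)
  have hqr := h.le _ q2
  simp only at *
  have hz : (0, z) ∉ T := by
    rcases lt_trichotomy z m with hh | hh | hh
    · exact p4 z (by omega) hh
    · exact hh ▸ hmT
    · exact q3 z z2 hh
  have hcomp : ∀ y ∈ T, y ≠ (p+1, q) → ¬ Cross y (0, z) ∧ ¬ Cross (0, z) y := by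
    rintro ⟨u, v⟩ hy hne
    refine ⟨by unfold Cross; simp, ?_⟩
    rintro ⟨c1, c2, c3⟩
    simp only at c1 c2 c3
    have A1 := h.nc _ q2 _ hy
    unfold Cross at A1
    simp only at A1
    have A2 : p = 0 ∨ p + 1 ≤ u := by
      rcases p3 with p3 | p3
      · exact Or.inl p3
      · right
        have := h.nc _ p3 _ hy
        unfold Cross at this
        simp only at this
        omega
    have A3 : u ≤ p + 1 := by
      rcases z3 with z3 | z3
      · omega
      · have := h.nc _ z3 _ hy
        unfold Cross at this
        simp only at this
        omega
    have A4 : u = p + 1 := by omega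
    subst A4
    have : v ≠ q := fun e => hne (by rw [e])
    exact z4 v c3 (by omega) hy
  refine ⟨(p+1, q), ?_, z, by simp, by omega, by omega, hz, hcomp⟩
  by_contra hx
  exact hz (h.mem_of hc (0, z) (by simp only; omega) (by simp only; omega)
    (fun y hy => hcomp y hy (fun e => hx (e ▸ hy))))
end TiltA

namespace TiltA
section modules
variable {K : Type} [Field K] {n : ℕ}

/-- The upper triangular algebra with a single ring instance path -/
def UT (K : Type) [Field K] (n : ℕ) : Type := ↥(UpperTriangular K n)

/-- its ring structure -/
def UTring (K : Type) [Field K] (n : ℕ) : Ring (UT K n) := (UpperTriangular K n).toRing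

instance instRingUT : Ring (UT K n) := UTring K n

/-- its algebra structure -/
def UTalg (K : Type) [Field K] (n : ℕ) : Algebra K (UT K n) := (UpperTriangular K n).algebra

instance instAlgUT : Algebra K (UT K n) := UTalg K n

theorem UT_ext {A B : UT K n} (h : ∀ i j, A.1 i j = B.1 i j) : A = B :=
  Subtype.ext (Matrix.ext h)

theorem UT_sum (f : Fin n → UT K n) (i j : Fin n) : (∑ l, f l).1 i j = ∑ l, (f l).1 i j := by
  let φ : UT K n →+ K :=
    { toFun := fun A => A.1 i j
      map_zero' := rfl
      map_add' := fun _ _ => rfl }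
  exact map_sum φ f Finset.univ

/-- The standard module of column vectors. -/
def Vec (K : Type) (n : ℕ) : Type := Fin n → K

noncomputable instance : AddCommGroup (Vec K n) := inferInstanceAs (AddCommGroup (Fin n → K))

noncomputable instance : Module (UT K n) (Vec K n) where
  smul A v := fun i => ∑ j, A.1 i j * v j
  one_smul v := by
    funext i
    change ∑ j, (1 : Matrix (Fin n) (Fin n) K) i j * v j = v i
    rw [Finset.sum_eq_single i]
    · simp
    · intro j _ hj; rw [Matrix.one_apply_ne hj.symm, zero_mul]
    · simp
  mul_smul A B v := by
    funext i
    change ∑ j, (A.1 * B.1) i j * v j = ∑ j, A.1 i j * ∑ l, B.1 j l * v l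
    simp only [Matrix.mul_apply, Finset.sum_mul, Finset.mul_sum]
    rw [Finset.sum_comm]
    simp only [mul_assoc]
  smul_zero A := by
    funext i
    change ∑ j, A.1 i j * (0 : K) = 0
    simp
  smul_add A v w := by
    funext i
    change ∑ j, A.1 i j * (v j + w j) = ∑ j, A.1 i j * v j + ∑ j, A.1 i j * w j
    simp [mul_add, Finset.sum_add_distrib]
  add_smul A B v := by
    funext i
    change ∑ j, (A.1 i j + B.1 i j) * v j = ∑ j, A.1 i j * v j + ∑ j, B.1 i j * v j
    simp [add_mul, Finset.sum_add_distrib]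
  zero_smul v := by
    funext i
    change ∑ j, (0 : K) * v j = 0
    simp

theorem vsmul_apply (A : UT K n) (v : Vec K n) (i : Fin n) :
    (A • v) i = ∑ j, A.1 i j * v j := rfl

theorem tri (A : UT K n) {i j : Fin n} (h : j < i) : A.1 i j = 0 := A.2 h

/-- vectors supported on the first `b` coordinates -/
def P (K : Type) [Field K] (n : ℕ) (b : ℕ) : Submodule (UT K n) (Vec K n) where
  carrier := {v | ∀ i : Fin n, b ≤ i.1 → v i = 0}
  zero_mem' := fun _ _ => rfl
  add_mem' := by
    intro v w hv hw i hi
    change v i + w i = 0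
    rw [hv i hi, hw i hi, add_zero]
  smul_mem' := by
    intro A v hv i hi
    rw [vsmul_apply]
    refine Finset.sum_eq_zero fun j _ => ?_
    by_cases h : j < i
    · rw [tri A h, zero_mul]
    · rw [hv j (by have := not_lt.1 h; exact hi.trans this), mul_zero]

theorem mem_P {b : ℕ} {v : Vec K n} : v ∈ P K n b ↔ ∀ i : Fin n, b ≤ i.1 → v i = 0 := Iff.rfl

theorem P_mono {a b : ℕ} (h : a ≤ b) : P K n a ≤ P K n b := fun _ hv i hi => hv i (h.trans hi)

/-- the upper triangular matrix whose column `β` is the truncation of `v` -/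
def col (β : Fin n) (v : Vec K n) : UT K n :=
  ⟨Matrix.of fun i j => if j = β ∧ i ≤ β then v i else 0, by
    intro i j hij
    simp only [id] at hij
    simp only [Matrix.of_apply]
    rw [if_neg]
    rintro ⟨rfl, h⟩
    exact absurd hij (not_lt.2 h)⟩

theorem col_apply (β : Fin n) (v : Vec K n) (i j : Fin n) :
    (col β v).1 i j = if j = β ∧ i ≤ β then v i else 0 := rfl

theorem col_smul (β : Fin n) (v w : Vec K n) (i : Fin n) :
    (col β v • w) i = if i ≤ β then v i * w β else 0 := by
  rw [vsmul_apply, Finset.sum_eq_single β]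
  · simp [col_apply]
  · intro j _ hj; simp [col_apply, hj]
  · simp

theorem col_add (β : Fin n) (v w : Vec K n) : col β (v + w) = col β v + col β w := by
  apply UT_ext
  intro i j
  change _ = (col β v).1 i j + (col β w).1 i j
  simp only [col_apply]
  split_ifs
  · rfl
  · simp

theorem mul_col (A : UT K n) (β : Fin n) (v : Vec K n) (hv : v ∈ P K n (β.1 + 1)) :
    A * col β v = col β (A • v) := by
  apply UT_ext
  intro i j
  change (A.1 * (col β v).1) i j = _
  rw [Matrix.mul_apply]
  simp only [col_apply]
  by_cases hj : j = β
  · by_cases hi : i ≤ β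
    · rw [if_pos ⟨hj, hi⟩, vsmul_apply]
      refine Finset.sum_congr rfl fun l _ => ?_
      by_cases hl : l ≤ β
      · simp [hj, hl]
      · rw [hv l (by have := not_le.1 hl; exact this)]; simp
    · rw [if_neg (fun h => hi h.2)]
      refine Finset.sum_eq_zero fun l _ => ?_
      by_cases hl : l ≤ β
      · rw [tri A (lt_of_le_of_lt hl (not_le.1 hi)), zero_mul]
      · rw [if_neg (fun h => hl h.2), mul_zero]
  · simp [hj]

/-- basis vector -/
def bv (K : Type) [Field K] {n : ℕ} (α : Fin n) : Vec K n := Pi.single α (1 : K)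

theorem bv_apply (α i : Fin n) : bv K α i = if i = α then 1 else 0 := by
  unfold bv; rw [Pi.single_apply]

theorem bv_mem (α : Fin n) {b : ℕ} (h : α.1 < b) : bv K α ∈ P K n b := by
  intro i hi
  rw [bv_apply, if_neg]
  rintro rfl
  omega

/-- matrix units -/
def E (K : Type) [Field K] {n : ℕ} (α β : Fin n) : UT K n := col β (bv K α)

theorem E_apply (α β i j : Fin n) : (E K α β).1 i j = if j = β ∧ i = α ∧ α ≤ β then 1 else 0 := by
  unfold E
  rw [col_apply, bv_apply]
  by_cases h1 : j = β <;> by_cases h2 : i = α <;> simp [h1, h2]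

theorem E_smul (α β : Fin n) (h : α ≤ β) (w : Vec K n) (i : Fin n) :
    (E K α β • w) i = if i = α then w β else 0 := by
  unfold E
  rw [col_smul, bv_apply]
  by_cases h2 : i = α <;> simp [h2, h]

theorem E_zero (α β : Fin n) (h : β < α) : E K α β = 0 := by
  apply UT_ext
  intro i j
  rw [E_apply, if_neg]
  · rfl
  · rintro ⟨-, -, h'⟩; exact absurd h (not_lt.2 h')

/-- `E i j * A = ∑ A j l E i l` -/
theorem E_mul (i j : Fin n) (h : i ≤ j) (A : UT K n) :
    E K i j * A = ∑ l, A.1 j l • E K i l := by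
  apply UT_ext
  intro s t
  rw [UT_sum]
  change ((E K i j).1 * A.1) s t = ∑ l, A.1 j l * (E K i l).1 s t
  rw [Matrix.mul_apply, Finset.sum_eq_single j, Finset.sum_eq_single t]
  · simp only [E_apply]
    by_cases hs : s = i
    · by_cases ht : i ≤ t
      · simp [hs, ht, h]
      · simp [hs, ht, h, tri A (lt_of_lt_of_le (not_le.1 ht) h)]
    · simp [hs]
  · intro l _ hl; rw [E_apply, if_neg]; · simp
    exact fun h => hl h.1.symm
  · simp
  · intro l _ hl; rw [E_apply, if_neg]; · simp
    exact fun h => hl h.1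
  · simp

theorem E_mul_col (i j β : Fin n) (h : i ≤ j) (v : Vec K n) (hv : v ∈ P K n (β.1 + 1)) :
    E K i j * col β v = v j • E K i β := by
  rw [mul_col _ _ _ hv]
  apply UT_ext
  intro s t
  change _ = v j * (E K i β).1 s t
  rw [col_apply, E_smul _ _ h, E_apply]
  by_cases h1 : t = β <;> by_cases h2 : s = i <;> simp [h1, h2]

theorem E_mul_E (i j l : Fin n) (h : i ≤ j) (h' : j ≤ l) : E K i j * E K j l = E K i l := by
  have := E_mul_col (K := K) i j l h (bv K j) (bv_mem j (Nat.lt_succ_of_le h'))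
  rw [bv_apply, if_pos rfl, one_smul] at this
  exact this

/-- Given `m` in a module, the hom `P (β+1) → M` sending the generator to `m` (projected). -/
noncomputable def homOf {M : Type} [AddCommGroup M] [Module (UT K n) M] (β : Fin n) (m : M) :
    P K n (β.1 + 1) →ₗ[UT K n] M where
  toFun v := col β v.1 • m
  map_add' v w := by
    rw [← add_smul, ← col_add]; rfl
  map_smul' A v := by
    rw [RingHom.id_apply, smul_smul, mul_col _ _ _ v.2]; rfl

theorem homOf_apply {M : Type} [AddCommGroup M] [Module (UT K n) M] (β : Fin n) (m : M)
    (v : P K n (β.1 + 1)) : homOf β m v = col β v.1 • m := rfl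

theorem col_smul_bv (β : Fin n) (v : Vec K n) (hv : v ∈ P K n (β.1 + 1)) : col β v • bv K β = v := by
  funext i
  rw [col_smul, bv_apply, if_pos rfl, mul_one]
  split_ifs with h
  · rfl
  · exact (hv i (not_le.1 h)).symm

/-- generator of P -/
def gen (K : Type) [Field K] {n : ℕ} (β : Fin n) : P K n (β.1 + 1) :=
  ⟨bv K β, bv_mem β (Nat.lt_succ_self _)⟩

theorem col_smul_gen (β : Fin n) (v : P K n (β.1 + 1)) : col β v.1 • gen K β = v :=
  Subtype.ext (col_smul_bv β v.1 v.2)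

instance P_proj (b : Fin n) : Module.Projective (UT K n) (P K n (b.1 + 1)) := by
  refine Module.Projective.of_split (homOf b (1 : UT K n))
    (LinearMap.toSpanSingleton _ _ (gen K b)) ?_
  ext1 v
  simp only [LinearMap.comp_apply, homOf_apply, LinearMap.toSpanSingleton_apply, smul_eq_mul,
    mul_one, LinearMap.id_apply]
  exact col_smul_gen b v

instance P_fin (b : Fin n) : Module.Finite (UT K n) (P K n (b.1 + 1)) := by
  refine Module.Finite.of_surjective (LinearMap.toSpanSingleton _ _ (gen K b)) fun v => ?_
  exact ⟨col b v.1, col_smul_gen b v⟩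

/-- interval module -/
abbrev Int (K : Type) [Field K] (n : ℕ) (a b : ℕ) : Type :=
  (P K n b) ⧸ (P K n a).submoduleOf (P K n b)

theorem mk_eq_mk {a b : ℕ} (v w : P K n b) :
    (Submodule.Quotient.mk v : Int K n a b) = Submodule.Quotient.mk w ↔
      ∀ i : Fin n, a ≤ i.1 → v.1 i = w.1 i := by
  rw [Submodule.Quotient.eq]
  change (∀ i : Fin n, a ≤ i.1 → v.1 i - w.1 i = 0) ↔ _
  simp only [sub_eq_zero]

theorem mk_eq_zero {a b : ℕ} (v : P K n b) :
    (Submodule.Quotient.mk v : Int K n a b) = 0 ↔ ∀ i : Fin n, a ≤ i.1 → v.1 i = 0 :=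
  mk_eq_mk v 0

theorem supp_iff {a b : ℕ} (i : Fin n) :
    (∃ m : Int K n a b, E K i i • m ≠ 0) ↔ a ≤ i.1 ∧ i.1 < b := by
  constructor
  · rintro ⟨m, hm⟩
    obtain ⟨v, rfl⟩ := Submodule.Quotient.mk_surjective _ m
    by_contra hc
    apply hm
    rw [← Submodule.Quotient.mk_smul, mk_eq_zero]
    intro j hj
    change (E K i i • v.1) j = 0
    rw [E_smul _ _ le_rfl]
    split_ifs with h
    · subst h
      exact v.2 _ (by omega)
    · rfl
  · rintro ⟨h1, h2⟩
    refine ⟨Submodule.Quotient.mk ⟨bv K i, bv_mem i h2⟩, fun h => ?_⟩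
    rw [← Submodule.Quotient.mk_smul, mk_eq_zero] at h
    have := h i h1
    change (E K i i • bv K i) i = 0 at this
    rw [E_smul _ _ le_rfl, if_pos rfl, bv_apply, if_pos rfl] at this
    exact one_ne_zero this

theorem Int_iso {a b c d : ℕ} (hab : a < b) (hb : b ≤ n) (hcd : c < d) (hd : d ≤ n)
    (e : Int K n a b ≃ₗ[UT K n] Int K n c d) : a = c ∧ b = d := by
  have key : ∀ i : Fin n, (a ≤ i.1 ∧ i.1 < b) ↔ (c ≤ i.1 ∧ i.1 < d) := by
    intro i
    rw [← supp_iff (K := K), ← supp_iff (K := K)]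
    constructor
    · rintro ⟨m, hm⟩
      refine ⟨e m, fun h => hm ?_⟩
      rw [← map_smul] at h
      exact (LinearEquiv.map_eq_zero_iff e).1 h
    · rintro ⟨m, hm⟩
      refine ⟨e.symm m, fun h => hm ?_⟩
      rw [← map_smul] at h
      exact (LinearEquiv.map_eq_zero_iff e.symm).1 h
  have k1 := key ⟨a, by omega⟩
  have k2 := key ⟨c, by omega⟩
  have k3 := key ⟨b - 1, by omega⟩
  have k4 := key ⟨d - 1, by omega⟩
  simp only at k1 k2 k3 k4
  omega

/-- every nonzero element generates the socle -/
theorem Int_socle {a b : ℕ} (hab : a < b) (hb : b ≤ n) (m : Int K n a b) (hm : m ≠ 0) :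
    ∃ A : UT K n, A • m =
      Submodule.Quotient.mk ⟨bv K ⟨a, by omega⟩, bv_mem _ hab⟩ := by
  obtain ⟨v, rfl⟩ := Submodule.Quotient.mk_surjective _ m
  rw [Ne, mk_eq_zero] at hm
  push Not at hm
  obtain ⟨j, hj, hv⟩ := hm
  refine ⟨(v.1 j)⁻¹ • E K ⟨a, by omega⟩ j, ?_⟩
  rw [← Submodule.Quotient.mk_smul, mk_eq_mk]
  intro i hi
  change (((v.1 j)⁻¹ • E K ⟨a, by omega⟩ j) • v.1) i = _
  have : (((v.1 j)⁻¹ • E K ⟨a, by omega⟩ j) • v.1) i = (v.1 j)⁻¹ * (E K ⟨a, by omega⟩ j • v.1) i := by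
    rw [vsmul_apply, vsmul_apply, Finset.mul_sum]
    refine Finset.sum_congr rfl fun l _ => ?_
    change (v.1 j)⁻¹ * _ * _ = _
    rw [mul_assoc]
  rw [this, E_smul _ _ hj]
  change _ = bv K ⟨a, by omega⟩ i
  rw [bv_apply]
  split_ifs
  · exact inv_mul_cancel₀ hv
  · simp

theorem Int_nontrivial {a b : ℕ} (hab : a < b) (hb : b ≤ n) :
    (Submodule.Quotient.mk ⟨bv K ⟨a, by omega⟩, bv_mem _ hab⟩ : Int K n a b) ≠ 0 := by
  rw [Ne, mk_eq_zero]
  intro h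
  have := h ⟨a, by omega⟩ le_rfl
  change bv K (⟨a, by omega⟩ : Fin n) ⟨a, by omega⟩ = 0 at this
  rw [bv_apply, if_pos rfl] at this
  exact one_ne_zero this

theorem Int_indec {a b : ℕ} (hab : a < b) (hb : b ≤ n) (Y Z : ModuleCat.{0} (UT K n))
    (e : ModuleCat.of (UT K n) (Int K n a b) ≅ Y ⊞ Z) :
    Limits.IsZero Y ∨ Limits.IsZero Z := by
  let f : Int K n a b ≃ₗ[UT K n] (Y × Z) :=
    (e ≪≫ ModuleCat.biprodIsoProd Y Z).toLinearEquiv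
  rw [ModuleCat.isZero_iff_subsingleton, ModuleCat.isZero_iff_subsingleton]
  by_contra hc
  push Not at hc
  obtain ⟨hY, hZ⟩ := hc
  obtain ⟨y, hy⟩ := exists_ne (0 : Y)
  obtain ⟨z, hz⟩ := exists_ne (0 : Z)
  obtain ⟨A, hA⟩ := Int_socle hab hb (f.symm (y, 0)) (by
    intro h
    rw [LinearEquiv.map_eq_zero_iff] at h
    exact hy (congrArg Prod.fst h))
  obtain ⟨B, hB⟩ := Int_socle hab hb (f.symm (0, z)) (by
    intro h
    rw [LinearEquiv.map_eq_zero_iff] at h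
    exact hz (congrArg Prod.snd h))
  have h := hA.trans hB.symm
  rw [← map_smul, ← map_smul] at h
  have h := f.symm.injective h
  have h1 : A • y = 0 := by
    have := congrArg Prod.fst h
    simpa using this
  have : A • ((y, 0) : Y × Z) = 0 := by
    ext <;> simp [h1]
  rw [← map_smul, this, map_zero] at hA
  exact Int_nontrivial hab hb hA.symm

/-- classification -/
theorem classify (M : ModuleCat.{0} (UT K n)) (hM : ¬ Limits.IsZero M)
    (ind : ∀ (Y Z : ModuleCat.{0} (UT K n)),
      (M ≅ Y ⊞ Z) → Limits.IsZero Y ∨ Limits.IsZero Z) :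
    ∃ a b : ℕ, a < b ∧ b ≤ n ∧ Nonempty (M ≅ ModuleCat.of (UT K n) (Int K n a b)) := by
  classical
  rw [ModuleCat.isZero_iff_subsingleton, not_subsingleton_iff_nontrivial] at hM
  have h1 : ∃ i : Fin n, ∃ m : M, E K i i • m ≠ 0 := by
    by_contra hc
    push Not at hc
    obtain ⟨m, hm⟩ := exists_ne (0 : M)
    apply hm
    have : (1 : UT K n) = ∑ i, E K i i := by
      apply UT_ext
      intro s t
      rw [UT_sum]
      simp only [E_apply]
      change (1 : Matrix (Fin n) (Fin n) K) s t = _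
      rw [Matrix.one_apply]
      by_cases h : s = t
      · subst h; simp
      · rw [if_neg h, Finset.sum_eq_zero]
        intro l _
        rw [if_neg]
        rintro ⟨rfl, rfl, -⟩
        exact h rfl
    rw [← one_smul (UT K n) m, this, Finset.sum_smul]
    exact Finset.sum_eq_zero fun i _ => hc i m
  obtain ⟨i, hi, hmin⟩ := WellFounded.has_min (wellFounded_lt (α := Fin n))
    {i | ∃ m : M, E K i i • m ≠ 0} h1
  have hmin' : ∀ j : Fin n, j < i → ∀ m : M, E K j j • m = 0 := by
    intro j hj m
    by_contra h
    exact hmin j ⟨m, h⟩ hj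
  obtain ⟨b, hb, hmax⟩ := WellFounded.has_min (wellFounded_gt (α := Fin n))
    {b | ∃ m : M, E K i b • m ≠ 0} ⟨i, hi⟩
  have hmax' : ∀ j : Fin n, b < j → ∀ m : M, E K i j • m = 0 := by
    intro j hj m
    by_contra h
    exact hmax j ⟨m, h⟩ hj
  have hib : i ≤ b := by
    by_contra h
    obtain ⟨m, hm⟩ := hb
    rw [E_zero _ _ (not_le.1 h), zero_smul] at hm
    exact hm rfl
  obtain ⟨x, hx⟩ := hb
  let _ : Module K M := Module.compHom M (algebraMap K (UT K n))
  have hsm : ∀ (c : K) (A : UT K n) (m : M), (c • A) • m = c • (A • m) := by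
    intro c A m
    rw [Algebra.smul_def, mul_smul]
    rfl
  obtain ⟨φ₀, hφ₀⟩ : ∃ φ : Module.Dual K M, φ (E K i b • x) ≠ 0 := by
    by_contra hc
    push Not at hc
    exact hx ((Module.forall_dual_apply_eq_zero_iff K _).1 hc)
  obtain ⟨φ, hφ⟩ : ∃ φ : Module.Dual K M, φ (E K i b • x) = 1 :=
    ⟨(φ₀ (E K i b • x))⁻¹ • φ₀, by simp [hφ₀]⟩
  have hψ : ∀ m : M, (fun j => φ (E K i j • m) : Vec K n) ∈ P K n (b.1 + 1) := by
    intro m j hj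
    change φ (E K i j • m) = 0
    rw [hmax' j hj, map_zero]
  let ρ : M →ₗ[UT K n] Int K n i.1 (b.1 + 1) :=
    { toFun := fun m => Submodule.Quotient.mk ⟨_, hψ m⟩
      map_add' := by
        intro m m'
        rw [← Submodule.Quotient.mk_add, mk_eq_mk]
        intro j hj
        change φ (E K i j • (m + m')) = φ (E K i j • m) + φ (E K i j • m')
        rw [smul_add, map_add]
      map_smul' := by
        intro A m
        rw [RingHom.id_apply, ← Submodule.Quotient.mk_smul, mk_eq_mk]
        intro j hj
        change φ (E K i j • (A • m)) = ∑ l, A.1 j l * φ (E K i l • m)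
        rw [smul_smul, E_mul _ _ hj, Finset.sum_smul, map_sum]
        refine Finset.sum_congr rfl fun l _ => ?_
        rw [hsm, map_smul, smul_eq_mul] }
  let σ : Int K n i.1 (b.1 + 1) →ₗ[UT K n] M :=
    Submodule.liftQ _ (homOf b x) (by
      intro v hv
      rw [LinearMap.mem_ker, homOf_apply]
      have hv' : v.1 ∈ P K n i.1 := hv
      have : col b v.1 = ∑ j, v.1 j • (E K j j * E K j b) := by
        apply UT_ext
        intro s t
        rw [UT_sum, Finset.sum_eq_single s]
        · change _ = v.1 s * (E K s s * E K s b).1 s t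
          by_cases hs : s ≤ b
          · rw [E_mul_E _ _ _ le_rfl hs, E_apply, col_apply]
            by_cases ht : t = b <;> simp [ht, hs]
          · rw [E_zero _ _ (not_le.1 hs), col_apply, if_neg (fun h => hs h.2), mul_zero]
            exact (mul_zero _).symm
        · intro l _ hl
          change v.1 l * (E K l l * E K l b).1 s t = 0
          by_cases hs : l ≤ b
          · rw [E_mul_E _ _ _ le_rfl hs, E_apply, if_neg, mul_zero]
            exact fun h => hl h.2.1.symm
          · rw [E_zero _ _ (not_le.1 hs), mul_zero]
            exact mul_zero _
        · simp
      rw [this, Finset.sum_smul]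
      refine Finset.sum_eq_zero fun j _ => ?_
      rw [hsm, mul_smul]
      by_cases hj : j < i
      · rw [hmin' j hj, smul_zero]
      · rw [hv' j (not_lt.1 hj), zero_smul])
  have hρσ : ∀ y, ρ (σ y) = y := by
    intro y
    obtain ⟨v, rfl⟩ := Submodule.Quotient.mk_surjective _ y
    change Submodule.Quotient.mk _ = _
    rw [mk_eq_mk]
    intro j hj
    change φ (E K i j • (col b v.1 • x)) = v.1 j
    rw [smul_smul, E_mul_col _ _ _ hj _ v.2, hsm, map_smul, hφ, smul_eq_mul, mul_one]
  let e : M ≃ₗ[UT K n] (Int K n i.1 (b.1 + 1) × LinearMap.ker ρ) :=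
    { toFun := fun m => (ρ m, ⟨m - σ (ρ m), by
        rw [LinearMap.mem_ker, map_sub, hρσ, sub_self]⟩)
      map_add' := by
        intro m m'
        ext
        · simp
        · simp; abel
      map_smul' := by
        intro A m
        ext
        · simp
        · simp [smul_sub]
      invFun := fun p => σ p.1 + p.2.1
      left_inv := by intro m; simp
      right_inv := by
        rintro ⟨y, z, hz⟩
        rw [LinearMap.mem_ker] at hz
        ext <;> simp [hρσ, hz] }
  have := ind (ModuleCat.of _ (Int K n i.1 (b.1 + 1))) (ModuleCat.of _ (LinearMap.ker ρ))
    (LinearEquiv.toModuleIso e ≪≫ (ModuleCat.biprodIsoProd (ModuleCat.of _ (Int K n i.1 (b.1 + 1)))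
      (ModuleCat.of _ (LinearMap.ker ρ))).symm)
  rcases this with h | h
  · rw [ModuleCat.isZero_iff_subsingleton] at h
    exact absurd (@Subsingleton.elim _ h _ _) (Int_nontrivial (K := K) (n := n) (Nat.lt_succ_of_le hib) b.2)
  · rw [ModuleCat.isZero_iff_subsingleton] at h
    refine ⟨i.1, b.1 + 1, Nat.lt_succ_of_le hib, b.2, ⟨LinearEquiv.toModuleIso
      (LinearEquiv.ofBijective ρ ⟨?_, fun y => ⟨σ y, hρσ y⟩⟩)⟩⟩
    rw [← LinearMap.ker_eq_bot, Submodule.eq_bot_iff]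
    intro m hm
    exact congrArg Subtype.val (@Subsingleton.elim _ h ⟨m, hm⟩ 0)


/-- the presentation of an interval module -/
noncomputable def pres (K : Type) [Field K] (n : ℕ) {a b : ℕ} (h : a ≤ b) :
    ShortComplex (ModuleCat.{0} (UT K n)) :=
  ShortComplex.mk (ModuleCat.ofHom (Submodule.inclusion (P_mono (K := K) (n := n) h)))
    (ModuleCat.ofHom ((P K n a).submoduleOf (P K n b)).mkQ) (by
      ext v
      change (Submodule.Quotient.mk _ : Int K n a b) = 0
      rw [mk_eq_zero]
      exact v.2)

theorem pres_exact {a b : ℕ} (h : a ≤ b) : (pres K n h).ShortExact := by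
  apply ModuleCat.shortComplex_shortExact
  · intro x
    constructor
    · intro hx
      have hx' := (mk_eq_zero (a := a) x).1 hx
      exact ⟨⟨x.1, hx'⟩, rfl⟩
    · rintro ⟨y, rfl⟩
      exact (mk_eq_zero (a := a) (Submodule.inclusion (P_mono (K := K) (n := n) h) y)).2 y.2
  · exact Submodule.inclusion_injective (P_mono (K := K) (n := n) h)
  · exact Submodule.mkQ_surjective _

theorem ext_iff [HasExt.{0} (ModuleCat.{0} (UT K n))] (a : ℕ) (β : Fin n) (h : a ≤ β.1 + 1)
    (N : ModuleCat.{0} (UT K n)) :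
    Subsingleton (Abelian.Ext (ModuleCat.of (UT K n) (Int K n a (β.1 + 1))) N 1) ↔
      ∀ f : P K n a →ₗ[UT K n] N, ∃ g : P K n (β.1 + 1) →ₗ[UT K n] N,
        ∀ v : P K n a, g (Submodule.inclusion (P_mono h) v) = f v := by
  have hS := pres_exact (K := K) (n := n) h
  have hproj : Projective (pres K n h).X₂ :=
    (IsProjective.iff_projective (R := UT K n) (P K n (β.1 + 1))).1 inferInstance
  constructor
  · intro hsub f
    have hsub' : Subsingleton (Abelian.Ext (pres K n h).X₃ N 1) := hsub
    let f' : (pres K n h).X₁ ⟶ N := ModuleCat.ofHom f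
    obtain ⟨x, hx⟩ := Abelian.Ext.contravariant_sequence_exact₁ hS N (Abelian.Ext.mk₀ f') (n₁ := 1)
      (by norm_num) (Subsingleton.elim _ _)
    obtain ⟨g, rfl⟩ := (Abelian.Ext.mk₀_bijective _ _).2 x
    rw [Abelian.Ext.mk₀_comp_mk₀] at hx
    have hx := (Abelian.Ext.mk₀_bijective _ _).1 hx
    refine ⟨g.hom, fun v => ?_⟩
    have := congrArg (fun t => t.hom v) hx
    exact this
  · intro hf
    change Subsingleton (Abelian.Ext (pres K n h).X₃ N 1)
    refine subsingleton_of_forall_eq 0 fun x => ?_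
    obtain ⟨y, rfl⟩ := Abelian.Ext.contravariant_sequence_exact₃ hS N x
      (Abelian.Ext.eq_zero_of_projective _) (n₀ := 0) (by norm_num)
    obtain ⟨f, rfl⟩ := (Abelian.Ext.mk₀_bijective _ _).2 y
    obtain ⟨g, hg⟩ := hf f.hom
    let g' : (pres K n h).X₂ ⟶ N := ModuleCat.ofHom g
    have : f = (pres K n h).f ≫ g' := by
      ext v
      exact (hg v).symm
    rw [this, ← Abelian.Ext.mk₀_comp_mk₀, hS.extClass_comp_assoc]

theorem ext_Int [HasExt.{0} (ModuleCat.{0} (UT K n))] {a b c d : ℕ} (hab : a < b) (hb : b ≤ n)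
    (hcd : c < d) (hd : d ≤ n) :
    Subsingleton (Abelian.Ext (ModuleCat.of (UT K n) (Int K n a b))
      (ModuleCat.of (UT K n) (Int K n c d)) 1) ↔ ¬ (c < a ∧ a ≤ d ∧ d < b) := by
  obtain ⟨β, rfl⟩ : ∃ β : Fin n, b = β.1 + 1 := ⟨⟨b - 1, by omega⟩, by simp only; omega⟩
  rw [ext_iff a β hab.le]
  rcases Nat.eq_zero_or_pos a with rfl | ha
  · refine iff_of_true (fun f => ⟨0, fun v => ?_⟩) (by omega)
    have : v = 0 := Subtype.ext (funext fun i => v.2 i (Nat.zero_le _))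
    rw [this]
    exact (map_zero f).symm
  obtain ⟨α, rfl⟩ : ∃ α : Fin n, a = α.1 + 1 := ⟨⟨a - 1, by omega⟩, by simp only; omega⟩
  have hαβ : α ≤ β := by
    change α.1 ≤ β.1
    omega
  constructor
  · rintro h ⟨h1, h2, h3⟩
    let m : Int K n c d := Submodule.Quotient.mk ⟨bv K α, bv_mem α h2⟩
    obtain ⟨g, hg⟩ := h (homOf α m)
    have h4 := hg (gen K α)
    have h5 : Submodule.inclusion (P_mono hab.le) (gen K α) = E K α β • gen K β :=
      (col_smul_gen β (Submodule.inclusion (P_mono hab.le) (gen K α))).symm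
    rw [h5, map_smul] at h4
    obtain ⟨w, hw⟩ := Submodule.Quotient.mk_surjective _ (g (gen K β))
    rw [← hw, homOf_apply] at h4
    have h6 : (Submodule.Quotient.mk (E K α β • w) : Int K n c d) =
      Submodule.Quotient.mk (E K α α • ⟨bv K α, bv_mem α h2⟩) := h4
    rw [mk_eq_mk] at h6
    have h7 := h6 α (by omega)
    change (E K α β • w.1) α = (E K α α • bv K α) α at h7
    rw [E_smul _ _ hαβ, E_smul _ _ le_rfl, bv_apply, if_pos rfl, if_pos rfl,
      if_pos rfl, w.2 β (by omega)] at h7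
    exact zero_ne_one h7
  · intro hc f
    obtain ⟨w, hw⟩ := Submodule.Quotient.mk_surjective _ (f (gen K α))
    -- the candidate image of the generator
    obtain ⟨m, hm⟩ : ∃ m : Int K n c d, E K α β • m = E K α α • f (gen K α) := by
      rw [← hw]
      by_cases h1 : c ≤ α.1 ∧ α.1 < d
      · refine ⟨Submodule.Quotient.mk ⟨col β (fun _ => w.1 α) • bv K β,
          Submodule.smul_mem _ _ (bv_mem β (by omega))⟩, ?_⟩
        rw [← Submodule.Quotient.mk_smul]
        refine Eq.trans ?_ (Submodule.Quotient.mk_smul _ _ _)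
        rw [mk_eq_mk]
        intro i hi
        change (E K α β • (col β (fun _ => w.1 α) • bv K β)) i = (E K α α • w.1) i
        rw [E_smul _ _ hαβ, E_smul _ _ le_rfl]
        refine if_congr Iff.rfl ?_ rfl
        refine (col_smul β (fun _ => w.1 α : Vec K n) (bv K β) β).trans ?_
        rw [if_pos le_rfl, bv_apply, if_pos rfl, mul_one]
      · refine ⟨0, ?_⟩
        rw [smul_zero]
        refine Eq.trans ?_ (Submodule.Quotient.mk_smul _ _ _)
        refine ((mk_eq_zero _).2 ?_).symm
        intro i hi
        change (E K α α • w.1) i = 0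
        rw [E_smul _ _ le_rfl]
        split_ifs with hiα
        · subst hiα
          exact w.2 _ (by omega)
        · rfl
    refine ⟨homOf β m, fun v => ?_⟩
    rw [homOf_apply]
    have e1 : col β (Submodule.inclusion (P_mono hab.le) v).1 = col α v.1 * E K α β := by
      unfold E
      rw [mul_col _ _ _ (bv_mem α (by omega)), col_smul_bv _ _ v.2]
      rfl
    have e2 : col α v.1 * E K α α = col α v.1 := by
      unfold E
      rw [mul_col _ _ _ (bv_mem α (by omega)), col_smul_bv _ _ v.2]
    rw [e1]
    refine (mul_smul _ _ m).trans ?_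
    rw [hm]
    refine (mul_smul _ _ _).symm.trans ?_
    rw [e2, ← map_smul, col_smul_gen]

theorem ext_congr [HasExt.{0} (ModuleCat.{0} (UT K n))] {X X' Y Y' : ModuleCat.{0} (UT K n)}
    (e : X ≅ X') (e' : Y ≅ Y') (h : Subsingleton (Abelian.Ext X Y 1)) :
    Subsingleton (Abelian.Ext X' Y' 1) := by
  refine subsingleton_of_forall_eq 0 fun x => ?_
  have h1 : (Abelian.Ext.mk₀ e.hom).comp (x.comp (Abelian.Ext.mk₀ e'.inv) (add_zero 1)) (zero_add 1)
    = 0 := Subsingleton.elim _ _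
  have h2 : (x.comp (Abelian.Ext.mk₀ e'.inv) (add_zero 1)) = 0 := by
    rw [← Abelian.Ext.mk₀_id_comp (x.comp (Abelian.Ext.mk₀ e'.inv) (add_zero 1)), ← e.inv_hom_id,
      ← Abelian.Ext.mk₀_comp_mk₀_assoc, h1, Abelian.Ext.comp_zero]
  rw [← Abelian.Ext.comp_mk₀_id x, ← e'.inv_hom_id, ← Abelian.Ext.mk₀_comp_mk₀,
    ← Abelian.Ext.comp_assoc_of_third_deg_zero, h2, Abelian.Ext.zero_comp]

theorem Int_fin {a b : ℕ} (hab : a < b) (hb : b ≤ n) : Module.Finite (UT K n) (Int K n a b) := by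
  obtain ⟨β, rfl⟩ : ∃ β : Fin n, b = β.1 + 1 := ⟨⟨b - 1, by omega⟩, by simp only; omega⟩
  infer_instance

end modules

section final
variable {K : Type} [Field K] {n : ℕ}

/-- admissible indexings of a tilting module -/
structure Adm (n : ℕ) (f : Fin n → ℕ × ℕ) : Prop where
  inj : Function.Injective f
  lt : ∀ i, (f i).1 < (f i).2
  le : ∀ i, (f i).2 ≤ n
  nc : ∀ i j, ¬ Cross (f i) (f j)

/-- interval modules as objects -/
noncomputable def IM (K : Type) [Field K] (n : ℕ) (p : ℕ × ℕ) :
    ModuleCat.{0} ↥(UpperTriangular K n) :=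
  (ModuleCat.of (UT K n) (Int K n p.1 p.2) : ModuleCat.{0} (UT K n))

theorem IM_inj {p q : ℕ × ℕ} (hp : p.1 < p.2) (hp' : p.2 ≤ n) (hq : q.1 < q.2) (hq' : q.2 ≤ n)
    (h : Nonempty (IM K n p ≅ IM K n q)) : p = q := by
  obtain ⟨e⟩ := h
  let e' : (ModuleCat.of (UT K n) (Int K n p.1 p.2) : ModuleCat.{0} (UT K n)) ≅
    ModuleCat.of (UT K n) (Int K n q.1 q.2) := e
  have := Int_iso hp hp' hq hq' e'.toLinearEquiv
  exact Prod.ext this.1 this.2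

theorem IM_ext [inst : HasExt.{0} (ModuleCat.{0} ↥(UpperTriangular K n))]
    {p q : ℕ × ℕ} (hp : p.1 < p.2) (hp' : p.2 ≤ n) (hq : q.1 < q.2) (hq' : q.2 ≤ n) :
    Subsingleton (Abelian.Ext (IM K n p) (IM K n q) 1) ↔ ¬ Cross q p :=
  @ext_Int K _ n inst p.1 p.2 q.1 q.2 hp hp' hq hq'

theorem ext_congr' [inst : HasExt.{0} (ModuleCat.{0} ↥(UpperTriangular K n))]
    {X X' Y Y' : ModuleCat.{0} ↥(UpperTriangular K n)}
    (e : X ≅ X') (e' : Y ≅ Y') (h : Subsingleton (Abelian.Ext X Y 1)) :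
    Subsingleton (Abelian.Ext X' Y' 1) :=
  @ext_congr K _ n inst X X' Y Y' e e' h

theorem classify' (M : ModuleCat.{0} ↥(UpperTriangular K n)) (hM : ¬ Limits.IsZero M)
    (ind : ∀ (Y Z : ModuleCat.{0} ↥(UpperTriangular K n)),
      (M ≅ Y ⊞ Z) → Limits.IsZero Y ∨ Limits.IsZero Z) :
    ∃ p : ℕ × ℕ, p.1 < p.2 ∧ p.2 ≤ n ∧ Nonempty (M ≅ IM K n p) := by
  obtain ⟨a, b, h1, h2, h3⟩ := classify (K := K) (n := n) M hM ind
  exact ⟨(a, b), h1, h2, h3⟩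

variable [HasExt.{0} (ModuleCat.{0} ↥(UpperTriangular K n))]

/-- tilting family from combinatorial data -/
noncomputable def TF (f : Fin n → ℕ × ℕ) (hf : Adm n f) : TiltingFamily K n where
  M i := IM K n (f i)
  finite i := Int_fin (K := K) (hf.lt i) (hf.le i)
  nonzero i := by
    intro h
    have h' : Subsingleton (Int K n (f i).1 (f i).2) :=
      ModuleCat.subsingleton_of_isZero (R := UT K n)
        (M := ModuleCat.of (UT K n) (Int K n (f i).1 (f i).2)) h
    exact Int_nontrivial (K := K) (hf.lt i) (hf.le i) (Subsingleton.elim _ _)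
  indec i Y Z e := Int_indec (K := K) (hf.lt i) (hf.le i) Y Z e
  rigid i j := (IM_ext (hf.lt i) (hf.le i) (hf.lt j) (hf.le j)).2 (hf.nc j i)
  pairwise_noniso i j hij h :=
    hij (hf.inj (IM_inj (hf.lt i) (hf.le i) (hf.lt j) (hf.le j) h))

theorem TF_same (f g : Fin n → ℕ × ℕ) (hf : Adm n f) (hg : Adm n g)
    (h : ∀ i, ∃ j, g j = f i) : SameTilting K n (TF f hf) (TF g hg) := by
  choose s hs using h
  have hinj : Function.Injective s := by
    intro i j hij
    apply hf.inj
    rw [← hs, ← hs, hij]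
  refine ⟨Equiv.ofBijective s (Finite.injective_iff_bijective.1 hinj), fun i => ⟨eqToIso ?_⟩⟩
  change IM K n (f i) = IM K n (g (s i))
  rw [hs]

theorem exists_TF (T : TiltingFamily K n) :
    ∃ (f : Fin n → ℕ × ℕ) (hf : Adm n f), SameTilting K n T (TF f hf) := by
  choose f h1 h2 h3 using fun i => classify' (T.M i) (T.nonzero i) (T.indec i)
  have hf : Adm n f := by
    refine ⟨?_, h1, h2, ?_⟩
    · intro i j hij
      by_contra hne
      obtain ⟨e⟩ := h3 i
      obtain ⟨e'⟩ := h3 j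
      rw [← hij] at e'
      exact T.pairwise_noniso i j hne ⟨e ≪≫ e'.symm⟩
    · intro i j
      obtain ⟨e⟩ := h3 i
      obtain ⟨e'⟩ := h3 j
      exact (IM_ext (h1 j) (h2 j) (h1 i) (h2 i)).1 (ext_congr' e' e (T.rigid j i))
  exact ⟨f, hf, Equiv.refl _, h3⟩

theorem Adm.good {f : Fin n → ℕ × ℕ} (hf : Adm n f) : Good n (Finset.univ.image f) := by
  constructor
  · simpa using hf.lt
  · simpa using hf.le
  · simpa using fun i j => hf.nc i j

theorem Adm.card {f : Fin n → ℕ × ℕ} (hf : Adm n f) : (Finset.univ.image f).card = n := by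
  rw [Finset.card_image_of_injective _ hf.inj]; simp

theorem step {f : Fin n → ℕ × ℕ} (hf : Adm n f) (m : ℕ) (hm : 0 < m) (hmn : m ≤ n)
    (hmf : ∀ i, f i ≠ (0, m)) :
    ∃ (g : Fin n → ℕ × ℕ) (hg : Adm n g), MutationStep K n (TF f hf) (TF g hg) ∧
      (Finset.univ.filter fun i => (g i).1 ≠ 0).card < (Finset.univ.filter fun i => (f i).1 ≠ 0).card := by
  obtain ⟨x, hx, z, hx0, hz, hzn, hzT, hcomp⟩ := hf.good.flip hf.card m hm hmn (by simpa using hmf)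
  simp only [Finset.mem_image, Finset.mem_univ, true_and, not_exists] at hx hzT
  obtain ⟨i₀, rfl⟩ := hx
  have hcomp' : ∀ i, i ≠ i₀ → ¬ Cross (f i) (0, z) ∧ ¬ Cross (0, z) (f i) := fun i hi =>
    hcomp (f i) (by simp) (fun h => hi (hf.inj h))
  let g := Function.update f i₀ (0, z)
  have g0 : g i₀ = (0, z) := Function.update_self _ _ _
  have g1 : ∀ i, i ≠ i₀ → g i = f i := fun i hi => Function.update_of_ne hi _ _
  have hg : Adm n g := by
    refine ⟨?_, ?_, ?_, ?_⟩
    · intro i j hij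
      by_cases hi : i = i₀ <;> by_cases hj : j = i₀
      · rw [hi, hj]
      · rw [hi, g0, g1 j hj] at hij; exact absurd hij.symm (hzT j)
      · rw [hj, g0, g1 i hi] at hij; exact absurd hij (hzT i)
      · rw [g1 i hi, g1 j hj] at hij; exact hf.inj hij
    · intro i
      by_cases hi : i = i₀
      · rw [hi, g0]; exact hz
      · rw [g1 i hi]; exact hf.lt i
    · intro i
      by_cases hi : i = i₀
      · rw [hi, g0]; exact hzn
      · rw [g1 i hi]; exact hf.le i
    · intro i j
      by_cases hi : i = i₀ <;> by_cases hj : j = i₀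
      · rw [hi, hj]; unfold Cross; omega
      · rw [hi, g0, g1 j hj]; exact (hcomp' j hj).2
      · rw [hj, g0, g1 i hi]; exact (hcomp' i hi).1
      · rw [g1 i hi, g1 j hj]; exact hf.nc i j
  refine ⟨g, hg, ⟨Equiv.refl _, i₀, ?_, ?_⟩, ?_⟩
  · intro i hi
    refine ⟨eqToIso ?_⟩
    change IM K n (f i) = IM K n (g i)
    rw [g1 i hi]
  · intro h
    have := IM_inj (K := K) (hf.lt i₀) (hf.le i₀) (hg.lt i₀) (hg.le i₀) h
    rw [g0] at this
    exact hzT i₀ this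
  · apply Finset.card_lt_card
    rw [Finset.ssubset_iff_of_subset]
    · refine ⟨i₀, by simpa using hx0, by simp [g0]⟩
    · intro i
      simp only [Finset.mem_filter, Finset.mem_univ, true_and]
      by_cases hi : i = i₀
      · rw [hi, g0]; simp
      · rw [g1 i hi]; exact id

/-- one step in the tilting graph, up to isomorphism -/
def Stp (K : Type) [Field K] (n : ℕ) [HasExt.{0} (ModuleCat.{0} ↥(UpperTriangular K n))]
    (A B : TiltingFamily K n) : Prop := SameTilting K n A B ∨ MutationStep K n A B

theorem Stp_symm (A B : TiltingFamily K n) (h : Stp K n A B) : Stp K n B A := by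
  rcases h with (⟨σ, h⟩ | ⟨σ, i₀, h1, h2⟩)
  · refine Or.inl ⟨σ.symm, fun i => ?_⟩
    obtain ⟨e⟩ := h (σ.symm i)
    rw [Equiv.apply_symm_apply] at e
    exact ⟨e.symm⟩
  · refine Or.inr ⟨σ.symm, σ i₀, fun i hi => ?_, ?_⟩
    · obtain ⟨e⟩ := h1 (σ.symm i) (fun h => hi (by rw [← h, Equiv.apply_symm_apply]))
      rw [Equiv.apply_symm_apply] at e
      exact ⟨e.symm⟩
    · rintro ⟨e⟩
      rw [Equiv.symm_apply_apply] at e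
      exact h2 ⟨e.symm⟩

theorem fan_adm (n : ℕ) : Adm n (fun i => (0, i.1 + 1)) := by
  refine ⟨?_, ?_, ?_, ?_⟩
  · intro i j h
    simp only [Prod.mk.injEq] at h
    apply Fin.ext; omega
  · intro i; simp
  · intro i; exact i.2
  · intro i j; unfold Cross; simp

theorem to_fan (N : ℕ) : ∀ (f : Fin n → ℕ × ℕ) (hf : Adm n f),
    (Finset.univ.filter fun i => (f i).1 ≠ 0).card ≤ N →
    Relation.ReflTransGen (Stp K n) (TF f hf) (TF _ (fan_adm n)) := by
  induction N with
  | zero =>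
    intro f hf hN
    apply Relation.ReflTransGen.single
    left
    refine TF_same _ _ _ _ fun i => ?_
    have h0 : (f i).1 = 0 := by
      by_contra h
      have : i ∈ Finset.univ.filter fun i => (f i).1 ≠ 0 := by simpa using h
      rw [Finset.card_eq_zero.1 (Nat.le_zero.1 hN)] at this
      simp at this
    have h1 := hf.lt i
    have h2 := hf.le i
    refine ⟨⟨(f i).2 - 1, by omega⟩, Prod.ext h0.symm ?_⟩
    simp only; omega
  | succ N ih =>
    intro f hf hN
    by_cases hc : ∀ m, 0 < m → m ≤ n → ∃ i, f i = (0, m)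
    · apply Relation.ReflTransGen.single
      apply Stp_symm
      left
      exact TF_same _ _ _ _ fun i => hc _ (Nat.succ_pos _) i.2
    · push Not at hc
      obtain ⟨m, h1, h2, h3⟩ := hc
      obtain ⟨g, hg, hs, hlt⟩ := step (K := K) hf m h1 h2 h3
      exact Relation.ReflTransGen.head (Or.inr hs) (ih g hg (by omega))

theorem main_thm (T T' : TiltingFamily K n) : Relation.ReflTransGen (Stp K n) T T' := by
  have key : ∀ T : TiltingFamily K n, Relation.ReflTransGen (Stp K n) T (TF _ (fan_adm n)) := by
    intro T
    obtain ⟨f, hf, h⟩ := exists_TF T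
    exact Relation.ReflTransGen.head (Or.inl h) (to_fan _ f hf le_rfl)
  have sy : ∀ A B, Relation.ReflTransGen (Stp K n) A B → Relation.ReflTransGen (Stp K n) B A := by
    intro A B h
    induction h with
    | refl => exact Relation.ReflTransGen.refl
    | tail _ hbc ih => exact Relation.ReflTransGen.head (Stp_symm _ _ hbc) ih
  exact (key T).trans (sy _ _ (key T'))

end final
end TiltA

/-- The tilting graph of `kA_r` (linearly oriented) is connected. -/
theorem tilting_graph_of_linear_quiver_connected (T T' : TiltingFamily k r) :
    Relation.ReflTransGen
      (fun A B => SameTilting k r A B ∨ MutationStep k r A B) T T' := by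
  exact TiltA.main_thm T T'
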